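/- Let X be a square integrable random variable on the classical Wiener space and n ≥ 1. Then ‖Γ(1/√n) X^{⋄n}‖_{L²(P)} ≤ ‖X‖_{L²(P)}^n; equivalently, ‖X^{⋄n}‖_{L²(P)} ≤ ‖Γ(√n)X‖_{L²(P)}^n. -/

import Mathlib

open MeasureTheory ProbabilityTheory Filter Topology
open scoped ENNReal NNReal

noncomputable section

namespace WickPaper

/-- Lebesgue measure on the cube `[0,T]^n`. -/
def boxMeasure (T : ℝ) (n : ℕ) : Measure (Fin n → ℝ) :=
  Measure.pi fun _ => (volume : Measure ℝ).restrict (Set.Icc 0 T)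

instance (T : ℝ) (n : ℕ) : IsFiniteMeasure (boxMeasure T n) := by
  unfold boxMeasure; infer_instance

/-- `L²([0,T]^n)`. -/
abbrev Ker (T : ℝ) (n : ℕ) := Lp ℝ 2 (boxMeasure T n)

/-- A formal Wiener–Itô chaos series: the sequence of its kernels. -/
abbrev Chaos (T : ℝ) := (n : ℕ) → Ker T n

/-- A kernel is symmetric if it is invariant (a.e.) under permutations of its variables. -/
def IsSymmKer {T : ℝ} {n : ℕ} (h : Ker T n) : Prop :=
  ∀ σ : Equiv.Perm (Fin n),
    (fun x : Fin n → ℝ => (h : (Fin n → ℝ) → ℝ) (x ∘ σ)) =ᵐ[boxMeasure T n]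
      (h : (Fin n → ℝ) → ℝ)

/-- The (possibly infinite) squared `L²(P)`-norm `Σ_n n! |c_n|²` of a chaos series. -/
def chaosNorm2 {T : ℝ} (c : Chaos T) : ℝ≥0∞ :=
  ∑' n : ℕ, (Nat.factorial n : ℝ≥0∞) * (‖c n‖₊ : ℝ≥0∞) ^ 2

/-- A chaos series represents a square-integrable random variable iff `Σ_n n! |c_n|² < ∞`. -/
def ChaosL2 {T : ℝ} (c : Chaos T) : Prop := chaosNorm2 c < ⊤

/-- The second quantization operator `Γ(λ)` on chaos series:  `(Γ(λ)c)_n = λ^n c_n`. -/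
def Gam {T : ℝ} (lam : ℝ) (c : Chaos T) : Chaos T := fun n => lam ^ n • c n

/-- Transport of kernels along an equality of orders. -/
def kerCast {T : ℝ} {j n : ℕ} (h : j = n) (f : Ker T j) : Ker T n := h ▸ f

/-- The sample space of the classical Wiener space over `[0,T]`: continuous paths. -/
abbrev PathSpace (T : ℝ) := C(Set.Icc (0 : ℝ) T, ℝ)

instance (T : ℝ) : MeasurableSpace (PathSpace T) := borel _

instance (T : ℝ) : BorelSpace (PathSpace T) := ⟨rfl⟩

/-- The classical Wiener space over `[0,T]`, together with its Wiener–Itô chaos machinery: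
`P` is the Wiener measure (the coordinate process is a Brownian motion), `I n` is the `n`-th
order multiple Itô integral, `kernels X` is the (unique, symmetric) sequence of kernels in the
Wiener–Itô chaos decomposition of `X`, and `stp` is the symmetrized tensor product of kernels. -/
structure WienerSpace (T : ℝ) where
  T_pos : 0 < T
  /-- the Wiener measure -/
  P : Measure (PathSpace T)
  probP : IsProbabilityMeasure P
  /-- the coordinate process starts at `0` -/
  coord_start : ∀ᵐ ω ∂P, ω ⟨0, Set.left_mem_Icc.mpr T_pos.le⟩ = 0
  /-- increments of the coordinate process are centered Gaussian -/
  coord_gauss : ∀ s t : Set.Icc (0 : ℝ) T, (s : ℝ) ≤ t →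
    Measure.map (fun ω : PathSpace T => ω t - ω s) P = gaussianReal 0 ((t : ℝ) - s).toNNReal
  /-- increments of the coordinate process over disjoint intervals are independent -/
  coord_indep : ∀ (n : ℕ) (t : Fin (n + 1) → Set.Icc (0 : ℝ) T),
    Monotone (fun i => (t i : ℝ)) →
    iIndepFun (m := fun _ => Real.measurableSpace)
      (fun (i : Fin n) (ω : PathSpace T) => ω (t i.succ) - ω (t i.castSucc)) P
  /-- the `n`-th order multiple Itô integral -/
  I : (n : ℕ) → Ker T n → Lp ℝ 2 P
  I_linear : ∀ n : ℕ, IsLinearMap ℝ (I n)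
  /-- `I 0` of a kernel is the corresponding constant -/
  I_zero : ∀ h : Ker T 0,
    (I 0 h : PathSpace T → ℝ) =ᵐ[P] fun _ => ∫ x, h x ∂boxMeasure T 0
  /-- `I 1` is the Wiener integral: it is a centered Gaussian with variance `|h|²` -/
  I_one_gauss : ∀ h : Ker T 1,
    Measure.map (I 1 h : PathSpace T → ℝ) P = gaussianReal 0 (‖h‖₊ ^ 2)
  /-- multiple Itô integrals of order `≥ 1` are centered -/
  I_mean_zero : ∀ n : ℕ, 1 ≤ n → ∀ h : Ker T n, ∫ ω, (I n h) ω ∂P = 0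
  /-- the Itô isometry on symmetric kernels: `‖I_n(h)‖ = √(n!) |h|` -/
  I_norm : ∀ (n : ℕ) (h : Ker T n), IsSymmKer h →
    ‖I n h‖ = Real.sqrt (Nat.factorial n) * ‖h‖
  /-- homogeneous chaoses of different orders are orthogonal -/
  I_orth : ∀ {m n : ℕ}, m ≠ n → ∀ (h : Ker T m) (g : Ker T n),
    inner ℝ (I m h) (I n g) = (0 : ℝ)
  /-- the kernels of the Wiener–Itô chaos decomposition of a square integrable `X` -/
  kernels : Lp ℝ 2 P → Chaos T
  kernels_symm : ∀ (X : Lp ℝ 2 P) (n : ℕ), IsSymmKer (kernels X n)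
  /-- the chaos decomposition: `X = Σ_n I_n(h_n)` -/
  kernels_hasSum : ∀ X : Lp ℝ 2 P, HasSum (fun n => I n (kernels X n)) X
  /-- uniqueness of the chaos decomposition -/
  kernels_unique : ∀ (X : Lp ℝ 2 P) (c : Chaos T), (∀ n, IsSymmKer (c n)) →
    HasSum (fun n => I n (c n)) X → c = kernels X
  /-- `‖X‖² = Σ_n n! |h_n|²` -/
  norm_eq : ∀ X : Lp ℝ 2 P, (‖X‖₊ : ℝ≥0∞) ^ 2 = chaosNorm2 (kernels X)
  /-- the symmetrized tensor product `⊗̂` of kernels -/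
  stp : ∀ {j m : ℕ}, Ker T j → Ker T m → Ker T (j + m)
  stp_spec : ∀ {j m : ℕ} (h : Ker T j) (g : Ker T m),
    (stp h g : (Fin (j + m) → ℝ) → ℝ) =ᵐ[boxMeasure T (j + m)]
      fun x => ((Nat.factorial (j + m) : ℝ))⁻¹ *
        ∑ σ : Equiv.Perm (Fin (j + m)),
          h (fun i => x (σ (Fin.castAdd m i))) * g (fun i => x (σ (Fin.natAdd j i)))
  /-- the `n`-fold tensor power `h^{⊗n}` of a one-variable kernel -/
  tpow : Ker T 1 → (n : ℕ) → Ker T n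
  tpow_spec : ∀ (h : Ker T 1) (n : ℕ),
    (tpow h n : (Fin n → ℝ) → ℝ) =ᵐ[boxMeasure T n] fun x => ∏ i, h (fun _ => x i)

namespace WienerSpace

variable {T : ℝ}

/-- `Z ∈ L²(P)` is the random variable with chaos decomposition `c`, i.e. `Z = Σ_n I_n(c_n)`. -/
def Represents (S : WienerSpace T) (c : Chaos T) (Z : Lp ℝ 2 S.P) : Prop :=
  HasSum (fun n => S.I n (c n)) Z

/-- The Wick product of two chaos series: `(c ⋄ d)_n = Σ_{j=0}^n c_j ⊗̂ d_{n-j}`. -/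
def wickKer (S : WienerSpace T) (c d : Chaos T) : Chaos T := fun n =>
  ∑ j ∈ (Finset.range (n + 1)).attach,
    kerCast (Nat.add_sub_cancel' (Nat.lt_succ_iff.mp (Finset.mem_range.mp j.2)))
      (S.stp (c j) (d (n - j)))

/-- The constant kernel `1` of order `0`. -/
def oneKer (T : ℝ) : Ker T 0 :=
  (memLp_const (1 : ℝ) : MemLp (fun _ : Fin 0 → ℝ => (1 : ℝ)) 2 (boxMeasure T 0)).toLp _

/-- The chaos series of the constant random variable `1`. -/
def unitChaos (T : ℝ) : Chaos T := fun n =>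
  if h : 0 = n then kerCast h (oneKer T) else 0

/-- Wick powers `c^{⋄n}` (with `c^{⋄0} = 1`). -/
def wickPow (S : WienerSpace T) (c : Chaos T) : ℕ → Chaos T
  | 0 => unitChaos T
  | n + 1 => S.wickKer (S.wickPow c n) c

/-- The `n`-fold Wick product `c 0 ⋄ ⋯ ⋄ c (n-1)`. -/
def wickFold (S : WienerSpace T) {n : ℕ} (c : Fin n → Chaos T) : Chaos T :=
  (List.ofFn c).foldr S.wickKer (unitChaos T)

/-- The stochastic exponential `ℰ(h) = exp{∫₀^T h dB − ½∫₀^T h² ds}`, where `∫₀^T h dB = I_1(h)`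
is the Wiener integral of `h` and `∫₀^T h² ds = ‖h‖²`. -/
def stochExp (S : WienerSpace T) (h : Ker T 1) : PathSpace T → ℝ := fun ω =>
  Real.exp ((S.I 1 h : PathSpace T → ℝ) ω - ‖h‖ ^ 2 / 2)

/-- The stochastic exponential with purely imaginary argument:
`ℰ(ih) = exp{i ∫₀^T h dB − ½∫₀^T (ih)² ds} = exp{i I_1(h) + ‖h‖²/2}`. -/
def stochExpI (S : WienerSpace T) (h : Ker T 1) : PathSpace T → ℂ := fun ω =>
  Complex.exp (Complex.I * ((S.I 1 h : PathSpace T → ℝ) ω : ℂ) + (‖h‖ : ℂ) ^ 2 / 2)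

/-- The Ornstein–Uhlenbeck semigroup:
`(P_t X)(ω) = ∫ X(e^{−t} ω + √(1 − e^{−2t}) ω̃) dP(ω̃)`. -/
def ou (S : WienerSpace T) (t : ℝ) (X : PathSpace T → ℝ) : PathSpace T → ℝ := fun ω =>
  ∫ ω' : PathSpace T,
    X (Real.exp (-t) • ω + Real.sqrt (1 - Real.exp (-2 * t)) • ω') ∂S.P

end WienerSpace

/-- Convergence in distribution of real random variables on a measure space towards a law `ν`,
tested against bounded continuous functions. -/
def TendstoInDistribution {α : Type*} [MeasurableSpace α] (P : Measure α)
    (Xn : ℕ → α → ℝ) (ν : Measure ℝ) : Prop :=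
  ∀ f : BoundedContinuousFunction ℝ ℝ,
    Tendsto (fun n => ∫ ω, f (Xn n ω) ∂P) atTop (𝓝 (∫ x, f x ∂ν))

/-- Positive definiteness of a complex-valued function on `L²([0,T])`. -/
def PosDefFn {T : ℝ} (φ : Ker T 1 → ℂ) : Prop :=
  ∀ (n : ℕ) (h : Fin n → Ker T 1) (c : Fin n → ℂ),
    0 ≤ (∑ i, ∑ j, c i * (starRingEnd ℂ) (c j) * φ (h i - h j)).re ∧
      (∑ i, ∑ j, c i * (starRingEnd ℂ) (c j) * φ (h i - h j)).im = 0

end WickPaper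

namespace WickPaper

/-- Restriction of a point of `[0,T]^(j+m)` to two complementary blocks of coordinates. -/
lemma mp_split (T : ℝ) (j m : ℕ) (σ : Equiv.Perm (Fin (j + m))) :
    MeasurePreserving (fun x : Fin (j + m) → ℝ =>
      ((fun i => x (σ (Fin.castAdd m i)) : Fin j → ℝ),
        (fun i => x (σ (Fin.natAdd j i)) : Fin m → ℝ)))
      (boxMeasure T (j + m)) ((boxMeasure T j).prod (boxMeasure T m)) := by
  have h1 := (measurePreserving_piCongrLeft (α := fun _ : Fin (j + m) => ℝ)
    (fun _ => (volume : Measure ℝ).restrict (Set.Icc 0 T)) (finSumFinEquiv.trans σ)).symm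
  have h2 := measurePreserving_sumPiEquivProdPi (X := fun _ : Fin j ⊕ Fin m => ℝ)
    (fun _ => (volume : Measure ℝ).restrict (Set.Icc 0 T))
  exact h2.comp h1

lemma eLpNorm_two_sq {α : Type*} [MeasurableSpace α] (μ : Measure α) (f : α → ℝ) :
    eLpNorm f 2 μ ^ 2 = ∫⁻ x, ‖f x‖ₑ ^ 2 ∂μ := by
  have := eLpNorm_nnreal_pow_eq_lintegral (μ := μ) (f := f) (p := 2) (by norm_num)
  simpa using this

lemma eLpNorm_split {T : ℝ} {j m : ℕ} (h : Ker T j) (g : Ker T m)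
    (σ : Equiv.Perm (Fin (j + m))) :
    AEStronglyMeasurable (fun x : Fin (j + m) → ℝ =>
      h (fun i => x (σ (Fin.castAdd m i))) * g (fun i => x (σ (Fin.natAdd j i))))
      (boxMeasure T (j + m)) ∧
    eLpNorm (fun x : Fin (j + m) → ℝ =>
      h (fun i => x (σ (Fin.castAdd m i))) * g (fun i => x (σ (Fin.natAdd j i)))) 2
      (boxMeasure T (j + m)) = ‖h‖ₑ * ‖g‖ₑ := by
  have hF : AEStronglyMeasurable (fun p : (Fin j → ℝ) × (Fin m → ℝ) => h p.1 * g p.2)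
      ((boxMeasure T j).prod (boxMeasure T m)) :=
    (Lp.aestronglyMeasurable h).comp_fst.mul (Lp.aestronglyMeasurable g).comp_snd
  refine ⟨hF.comp_measurePreserving (mp_split T j m σ), ?_⟩
  have := eLpNorm_comp_measurePreserving (p := 2) hF (mp_split T j m σ)
  refine Eq.trans this ?_
  rw [Lp.enorm_def, Lp.enorm_def]
  refine ENNReal.pow_right_strictMono two_ne_zero |>.injective ?_
  simp only [mul_pow, eLpNorm_two_sq, enorm_mul]
  exact lintegral_prod_mul ((Lp.aestronglyMeasurable h).enorm.pow_const 2)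
    ((Lp.aestronglyMeasurable g).enorm.pow_const 2)

lemma stp_norm_le {T : ℝ} (S : WienerSpace T) {j m : ℕ} (h : Ker T j) (g : Ker T m) :
    ‖S.stp h g‖₊ ≤ ‖h‖₊ * ‖g‖₊ := by
  have key : ‖S.stp h g‖ₑ ≤ ‖h‖ₑ * ‖g‖ₑ := by
    rw [Lp.enorm_def, eLpNorm_congr_ae (S.stp_spec h g)]
    set F : Equiv.Perm (Fin (j + m)) → (Fin (j + m) → ℝ) → ℝ := fun σ x =>
      h (fun i => x (σ (Fin.castAdd m i))) * g (fun i => x (σ (Fin.natAdd j i))) with hF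
    have e : (fun x => ((Nat.factorial (j + m) : ℝ))⁻¹ *
        ∑ σ : Equiv.Perm (Fin (j + m)),
          h (fun i => x (σ (Fin.castAdd m i))) * g (fun i => x (σ (Fin.natAdd j i)))) =
        ((Nat.factorial (j + m) : ℝ))⁻¹ • ∑ σ, F σ := by
      ext x; simp [hF]
    rw [e, eLpNorm_const_smul]
    have h1 : eLpNorm (∑ σ, F σ) 2 (boxMeasure T (j + m)) ≤
        (Nat.factorial (j + m) : ℝ≥0∞) * (‖h‖ₑ * ‖g‖ₑ) := by
      refine (eLpNorm_sum_le (fun σ _ => (eLpNorm_split h g σ).1) (by norm_num)).trans ?_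
      rw [Finset.sum_congr rfl (fun σ _ => (eLpNorm_split h g σ).2)]
      simp [Fintype.card_perm]
    have h2 : ‖((Nat.factorial (j + m) : ℝ))⁻¹‖ₑ = ((Nat.factorial (j + m) : ℝ≥0∞))⁻¹ := by
      rw [enorm_inv (by positivity)]
      simp
    rw [h2]
    calc _ ≤ ((Nat.factorial (j + m) : ℝ≥0∞))⁻¹ *
          ((Nat.factorial (j + m) : ℝ≥0∞) * (‖h‖ₑ * ‖g‖ₑ)) := by gcongr
      _ = _ := by
        rw [← mul_assoc, ENNReal.inv_mul_cancel (by simp [Nat.factorial_ne_zero]) (by simp),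
          one_mul]
  rw [enorm_eq_nnnorm, enorm_eq_nnnorm, enorm_eq_nnnorm] at key
  exact_mod_cast key

lemma kerCast_nnnorm {T : ℝ} {j n : ℕ} (h : j = n) (f : Ker T j) :
    ‖kerCast h f‖₊ = ‖f‖₊ := by
  subst h; rfl

lemma wickKer_norm_le {T : ℝ} (S : WienerSpace T) (c d : Chaos T) (n : ℕ) :
    ‖S.wickKer c d n‖₊ ≤ ∑ p ∈ Finset.HasAntidiagonal.antidiagonal n, ‖c p.1‖₊ * ‖d p.2‖₊ := by
  rw [Finset.Nat.sum_antidiagonal_eq_sum_range_succ (fun i k => ‖c i‖₊ * ‖d k‖₊),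
    ← Finset.sum_attach]
  unfold WienerSpace.wickKer
  refine (nnnorm_sum_le _ _).trans (Finset.sum_le_sum fun j _ => ?_)
  rw [kerCast_nnnorm]
  exact stp_norm_le S _ _

/-- The weighted squared norm `Σ_n n! t^n |c_n|²`. -/
def wN {T : ℝ} (t : ℝ≥0) (c : Chaos T) : ℝ≥0∞ :=
  ∑' n : ℕ, ((n.factorial * t ^ n * ‖c n‖₊ ^ 2 : ℝ≥0) : ℝ≥0∞)

lemma cauchy_step (a b : ℕ → ℝ≥0) (t u v : ℝ≥0) (hu : u ≠ 0) (hv : v ≠ 0)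
    (htuv : t * (u⁻¹ + v⁻¹) = 1) (n : ℕ) :
    n.factorial * t ^ n * (∑ p ∈ Finset.HasAntidiagonal.antidiagonal n, a p.1 * b p.2) ^ 2 ≤
      ∑ p ∈ Finset.HasAntidiagonal.antidiagonal n, (p.1.factorial * u ^ p.1 * a p.1 ^ 2) *
        (p.2.factorial * v ^ p.2 * b p.2 ^ 2) := by
  have h1 : (∑ p ∈ Finset.HasAntidiagonal.antidiagonal n, a p.1 * b p.2) ^ 2 ≤
      (∑ p ∈ Finset.HasAntidiagonal.antidiagonal n,
        ((p.1.factorial : ℝ≥0)⁻¹ * (p.2.factorial : ℝ≥0)⁻¹ * ((u⁻¹) ^ p.1 * (v⁻¹) ^ p.2))) *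
      ∑ p ∈ Finset.HasAntidiagonal.antidiagonal n, (p.1.factorial * u ^ p.1 * a p.1 ^ 2) *
        (p.2.factorial * v ^ p.2 * b p.2 ^ 2) := by
    refine Finset.sum_sq_le_sum_mul_sum_of_sq_le_mul _ (fun _ _ => zero_le) (fun _ _ => zero_le)
      (fun p _ => le_of_eq ?_)
    rw [inv_pow, inv_pow]
    have := Nat.factorial_ne_zero p.1
    have := Nat.factorial_ne_zero p.2
    field_simp
  have h2 : (n.factorial : ℝ≥0) * (∑ p ∈ Finset.HasAntidiagonal.antidiagonal n,
        ((p.1.factorial : ℝ≥0)⁻¹ * (p.2.factorial : ℝ≥0)⁻¹ * ((u⁻¹) ^ p.1 * (v⁻¹) ^ p.2))) =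
      (u⁻¹ + v⁻¹) ^ n := by
    rw [(Commute.all _ _).add_pow', Finset.mul_sum]
    refine Finset.sum_congr rfl fun p hp => ?_
    rw [Finset.HasAntidiagonal.mem_antidiagonal] at hp
    subst hp
    have h3 := Nat.add_choose_mul_factorial_mul_factorial p.1 p.2
    have h4 : (((p.1 + p.2).factorial : ℕ) : ℝ≥0) =
      ((p.1 + p.2).choose p.1 : ℝ≥0) * p.1.factorial * p.2.factorial := by
      rw [← h3, Nat.choose_symm_add]; push_cast; ring
    rw [h4, nsmul_eq_mul]
    have := Nat.factorial_ne_zero p.1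
    have := Nat.factorial_ne_zero p.2
    field_simp
  refine (mul_le_mul_right h1 _).trans (le_of_eq ?_)
  rw [← mul_assoc, mul_right_comm (n.factorial : ℝ≥0), h2, ← mul_pow, mul_comm _ t, htuv, one_pow,
    one_mul]

lemma tsum_anti (f g : ℕ → ℝ≥0∞) :
    ∑' n, ∑ p ∈ Finset.HasAntidiagonal.antidiagonal n, f p.1 * g p.2 =
      (∑' n, f n) * ∑' n, g n := by
  rw [← ENNReal.tsum_mul_right]
  simp_rw [← ENNReal.tsum_mul_left]
  rw [← ENNReal.tsum_prod (f := fun a b => f a * g b),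
    ← Finset.HasAntidiagonal.sigmaAntidiagonalEquivProd.tsum_eq, ENNReal.tsum_sigma']
  refine tsum_congr fun n => ?_
  rw [tsum_fintype, ← Finset.sum_coe_sort]
  rfl

lemma wN_wick {T : ℝ} (S : WienerSpace T) (c d : Chaos T) (t u v : ℝ≥0) (hu : u ≠ 0)
    (hv : v ≠ 0) (htuv : t * (u⁻¹ + v⁻¹) = 1) :
    wN t (S.wickKer c d) ≤ wN u c * wN v d := by
  unfold wN
  rw [← tsum_anti]
  refine ENNReal.tsum_le_tsum fun n => ?_
  have := (mul_le_mul_right (pow_le_pow_left₀ zero_le (wickKer_norm_le S c d n) 2)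
    (n.factorial * t ^ n)).trans
    (cauchy_step (fun i => ‖c i‖₊) (fun i => ‖d i‖₊) t u v hu hv htuv n)
  exact_mod_cast this

lemma oneKer_norm (T : ℝ) : ‖WienerSpace.oneKer T‖₊ ≤ 1 := by
  have : ‖WienerSpace.oneKer T‖ₑ ≤ 1 := by
    unfold WienerSpace.oneKer
    rw [Lp.enorm_toLp]
    rw [eLpNorm_const' _ (by norm_num) (by norm_num)]
    simp [boxMeasure]
  rw [enorm_eq_nnnorm] at this
  exact_mod_cast this

lemma wickPow_one_norm {T : ℝ} (S : WienerSpace T) (c : Chaos T) (n : ℕ) :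
    ‖S.wickPow c 1 n‖₊ ≤ ‖c n‖₊ := by
  refine (wickKer_norm_le S _ _ n).trans ?_
  rw [Finset.sum_eq_single (0, n)]
  · have : ‖S.wickPow c 0 0‖₊ ≤ 1 := by
      simp only [WienerSpace.wickPow, WienerSpace.unitChaos, dite_true, kerCast_nnnorm]
      exact oneKer_norm T
    simpa using mul_le_mul_left this ‖c n‖₊
  · rintro ⟨i, k⟩ hp hne
    rw [Finset.HasAntidiagonal.mem_antidiagonal] at hp
    have hi : ¬ (0 = i) := by
      rintro rfl
      apply hne
      simp at hp
      simp [hp]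
    simp [WienerSpace.wickPow, WienerSpace.unitChaos, hi]
  · intro h; simp at h

lemma wN_wickPow {T : ℝ} (S : WienerSpace T) (c : Chaos T) (s : ℝ≥0) (hs : s ≠ 0) (n : ℕ) :
    wN (s / (n + 1 : ℕ)) (S.wickPow c (n + 1)) ≤ wN s c ^ (n + 1) := by
  induction n with
  | zero =>
    simp only [zero_add, Nat.cast_one, div_one, pow_one]
    refine ENNReal.tsum_le_tsum fun n => ENNReal.coe_le_coe.2 ?_
    exact mul_le_mul_right (pow_le_pow_left₀ zero_le (wickPow_one_norm S c n) 2) _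
  | succ k ih =>
    rw [pow_succ]
    refine (wN_wick S _ c _ (s / (k + 1 : ℕ)) s ?_ hs ?_).trans (mul_le_mul_left ih _)
    · exact div_ne_zero hs (by simp)
    · have : ((k + 1 : ℕ) : ℝ≥0) ≠ 0 := by simp
      have : ((k + 1 + 1 : ℕ) : ℝ≥0) ≠ 0 := by simp
      field_simp
      push_cast; ring

lemma chaosNorm2_eq {T : ℝ} (c : Chaos T) : chaosNorm2 c = wN 1 c := by
  unfold chaosNorm2 wN
  refine tsum_congr fun n => ?_
  push_cast; simp

lemma chaosNorm2_Gam {T : ℝ} (lam : ℝ) (t : ℝ≥0) (h : ‖lam‖₊ ^ 2 = t) (c : Chaos T) :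
    chaosNorm2 (Gam lam c) = wN t c := by
  unfold chaosNorm2 wN Gam
  refine tsum_congr fun n => ?_
  rw [← h, nnnorm_smul, nnnorm_pow]
  push_cast; ring


/-- Theorem 2.1, equal factors. For square integrable `X` and `n ≥ 1`,
`‖Γ(1/√n) X^{⋄n}‖ ≤ ‖X‖^n`, and equivalently `‖X^{⋄n}‖ ≤ ‖Γ(√n)X‖^n` (the possibly infinite
`L²`-norms being computed from the chaos kernels). -/
theorem wick_power_norm_bound {T : ℝ} (S : WienerSpace T) (X : Lp ℝ 2 S.P)
    (n : ℕ) (hn : 1 ≤ n) :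
    chaosNorm2 (Gam (Real.sqrt n)⁻¹ (S.wickPow (S.kernels X) n)) ^ (1 / 2 : ℝ) ≤
      (‖X‖₊ : ℝ≥0∞) ^ n ∧
    chaosNorm2 (S.wickPow (S.kernels X) n) ^ (1 / 2 : ℝ) ≤
      (chaosNorm2 (Gam (Real.sqrt n) (S.kernels X)) ^ (1 / 2 : ℝ)) ^ n := by

  obtain ⟨k, rfl⟩ : ∃ k, n = k + 1 := ⟨n - 1, by omega⟩
  have hk : ((k + 1 : ℕ) : ℝ≥0) ≠ 0 := by simp
  have hs : ‖Real.sqrt (k + 1 : ℕ)‖₊ ^ 2 = ((k + 1 : ℕ) : ℝ≥0) := by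
    ext
    simp only [NNReal.coe_pow, coe_nnnorm, Real.norm_eq_abs, sq_abs, NNReal.coe_natCast]
    exact Real.sq_sqrt (by positivity)
  constructor
  · rw [chaosNorm2_Gam _ (1 / (k + 1 : ℕ)) (by rw [nnnorm_inv, inv_pow, hs, one_div])]
    have h := wN_wickPow S (S.kernels X) 1 one_ne_zero k
    rw [← chaosNorm2_eq, ← S.norm_eq] at h
    refine (ENNReal.rpow_le_rpow h (by norm_num)).trans (le_of_eq ?_)
    rw [← pow_mul, mul_comm, pow_mul, ← ENNReal.rpow_natCast, ← ENNReal.rpow_mul]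
    norm_num
  · rw [chaosNorm2_Gam _ _ hs, chaosNorm2_eq]
    have h := wN_wickPow S (S.kernels X) _ hk k
    rw [div_self hk] at h
    refine (ENNReal.rpow_le_rpow h (by norm_num)).trans (le_of_eq ?_)
    rw [← ENNReal.rpow_natCast, ← ENNReal.rpow_natCast, ← ENNReal.rpow_mul, ← ENNReal.rpow_mul,
      mul_comm]

end WickPaper
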